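/- Let n ≥ 1, T > 0, and let u be a smooth solution of the biharmonic heat equation on ℝⁿ × (0,T] such that for every compact set Ω ⊂ ℝⁿ, ∫_Ω u(x,t)² dx → 0 as t → 0⁺. Then for every R > 0, (1/t) · ∫_{B(0,R)} u(x,t)² dx → 0 as t → 0⁺. -/

import Mathlib

open MeasureTheory Metric Set Filter

/-- The Euclidean Laplacian `Δf = ∑ᵢ ∂²f/∂xᵢ²`. -/
noncomputable def lap {n : ℕ} (f : EuclideanSpace ℝ (Fin n) → ℝ) :
    EuclideanSpace ℝ (Fin n) → ℝ :=
  fun x => ∑ i : Fin n,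
    fderiv ℝ (fun y => fderiv ℝ f y (EuclideanSpace.single i 1)) x (EuclideanSpace.single i 1)

/-- `u = u(x,t)` is a smooth solution of the biharmonic heat equation
`∂ₜu = -Δ²u` on the set `S ⊆ ℝⁿ × ℝ`. -/
def IsBiharmonicHeatSol {n : ℕ} (u : EuclideanSpace ℝ (Fin n) → ℝ → ℝ)
    (S : Set (EuclideanSpace ℝ (Fin n) × ℝ)) : Prop :=
  ContDiffOn ℝ (⊤ : ℕ∞) (fun p => u p.1 p.2) S ∧
  ∀ p ∈ S, HasDerivWithinAt (fun s => u p.1 s)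
    (-(lap (lap (fun y => u y p.2)) p.1)) {s | (p.1, s) ∈ S} p.2

section SpatialEstimate

variable {n : ℕ}

local notation "E" => EuclideanSpace ℝ (Fin n)

/-- The `i`-th partial derivative of a function on Euclidean space. -/
noncomputable def partialDeriv (i : Fin n) (f : E → ℝ) : E → ℝ :=
  fun x => fderiv ℝ f x (EuclideanSpace.single i 1)

/-- The pointwise inner product `∇f · ∇g` of two gradients. -/
noncomputable def gradInner (f g : E → ℝ) : E → ℝ :=
  fun x => ∑ i, partialDeriv i f x * partialDeriv i g x

lemma lap_eq_sum_partialDeriv (f : E → ℝ) :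
    lap f = fun x => ∑ i, partialDeriv i (partialDeriv i f) x := rfl

lemma ContDiff.partialDeriv {f : E → ℝ} (hf : ContDiff ℝ (⊤ : ℕ∞) f) (i : Fin n) :
    ContDiff ℝ (⊤ : ℕ∞) (partialDeriv i f) :=
  (hf.fderiv_right (m := (⊤ : ℕ∞)) (by simp)).clm_apply contDiff_const

lemma ContDiff.lap {f : E → ℝ} (hf : ContDiff ℝ (⊤ : ℕ∞) f) :
    ContDiff ℝ (⊤ : ℕ∞) (lap f) :=
  ContDiff.sum fun i _ => (hf.partialDeriv i).partialDeriv i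

lemma ContDiff.gradInner {f g : E → ℝ} (hf : ContDiff ℝ (⊤ : ℕ∞) f)
    (hg : ContDiff ℝ (⊤ : ℕ∞) g) : ContDiff ℝ (⊤ : ℕ∞) (gradInner f g) :=
  ContDiff.sum fun i _ => (hf.partialDeriv i).mul (hg.partialDeriv i)

lemma partialDeriv_mul {f g : E → ℝ} (hf : ContDiff ℝ (⊤ : ℕ∞) f)
    (hg : ContDiff ℝ (⊤ : ℕ∞) g) (i : Fin n) :
    partialDeriv i (f * g) = f * partialDeriv i g + partialDeriv i f * g := by
  ext x
  have h := fderiv_mul (hf.differentiable (by simp) x) (hg.differentiable (by simp) x)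
  simp only [partialDeriv, h, Pi.add_apply, Pi.mul_apply, add_apply,
    smul_apply, smul_eq_mul]
  ring

lemma partialDeriv_add {f g : E → ℝ} (hf : ContDiff ℝ (⊤ : ℕ∞) f)
    (hg : ContDiff ℝ (⊤ : ℕ∞) g) (i : Fin n) :
    partialDeriv i (f + g) = partialDeriv i f + partialDeriv i g := by
  ext x
  have h := fderiv_add (hf.differentiable (by simp) x) (hg.differentiable (by simp) x)
  simp [partialDeriv, h]

lemma lap_mul {f g : E → ℝ} (hf : ContDiff ℝ (⊤ : ℕ∞) f)
    (hg : ContDiff ℝ (⊤ : ℕ∞) g) (x : E) :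
    lap (f * g) x = f x * lap g x + 2 * gradInner f g x + g x * lap f x := by
  simp only [lap_eq_sum_partialDeriv, gradInner, Finset.mul_sum, ← Finset.sum_add_distrib]
  refine Finset.sum_congr rfl fun i _ => ?_
  have hf' := hf.partialDeriv i
  have hg' := hg.partialDeriv i
  rw [partialDeriv_mul hf hg, partialDeriv_add (f := f * partialDeriv i g)
    (g := partialDeriv i f * g) (hf.mul hg') (hf'.mul hg),
    partialDeriv_mul hf hg', partialDeriv_mul hf' hg]
  simp only [Pi.add_apply, Pi.mul_apply]
  ring

lemma gradInner_mul_left {f g h : E → ℝ} (hf : ContDiff ℝ (⊤ : ℕ∞) f)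
    (hg : ContDiff ℝ (⊤ : ℕ∞) g) (x : E) :
    gradInner (f * g) h x = f x * gradInner g h x + g x * gradInner f h x := by
  simp only [gradInner, Finset.mul_sum, ← Finset.sum_add_distrib, partialDeriv_mul hf hg,
    Pi.add_apply, Pi.mul_apply]
  exact Finset.sum_congr rfl fun i _ => by ring

lemma gradInner_comm (f g : E → ℝ) : gradInner f g = gradInner g f := by
  ext x
  simp only [gradInner, mul_comm]

lemma gradInner_self_nonneg (f : E → ℝ) (x : E) : 0 ≤ gradInner f f x :=
  Finset.sum_nonneg fun _ _ => mul_self_nonneg _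

lemma gradInner_sq_le (f g : E → ℝ) (x : E) :
    gradInner f g x ^ 2 ≤ gradInner f f x * gradInner g g x := by
  simpa only [gradInner, sq] using
    Finset.sum_mul_sq_le_sq_mul_sq Finset.univ (partialDeriv · f x) (partialDeriv · g x)

lemma HasCompactSupport.partialDeriv {f : E → ℝ} (hf : HasCompactSupport f) (i : Fin n) :
    HasCompactSupport (partialDeriv i f) :=
  hf.fderiv_apply ℝ _

lemma integral_mul_partialDeriv {f g : E → ℝ} (hf : ContDiff ℝ (⊤ : ℕ∞) f)
    (hg : ContDiff ℝ (⊤ : ℕ∞) g) (hfc : HasCompactSupport f) (i : Fin n) :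
    ∫ x, f x * partialDeriv i g x = -∫ x, partialDeriv i f x * g x := by
  refine integral_mul_fderiv_eq_neg_fderiv_mul_of_integrable ?_ ?_ ?_
    (fun x _ => hf.differentiable (by simp) x) (fun x _ => hg.differentiable (by simp) x)
  · exact ((hf.partialDeriv i).continuous.mul hg.continuous).integrable_of_hasCompactSupport
      (hfc.partialDeriv i).mul_right
  · exact (hf.continuous.mul (hg.partialDeriv i).continuous).integrable_of_hasCompactSupport
      hfc.mul_right
  · exact (hf.continuous.mul hg.continuous).integrable_of_hasCompactSupport hfc.mul_right

/-- Green's identity for the Laplacian, one function having compact support. -/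
lemma integral_mul_lap {f g : E → ℝ} (hf : ContDiff ℝ (⊤ : ℕ∞) f)
    (hg : ContDiff ℝ (⊤ : ℕ∞) g) (hfc : HasCompactSupport f) :
    ∫ x, f x * lap g x = ∫ x, lap f x * g x := by
  simp only [lap_eq_sum_partialDeriv, Finset.mul_sum, Finset.sum_mul]
  rw [integral_finsetSum, integral_finsetSum]
  · refine Finset.sum_congr rfl fun i _ => ?_
    rw [integral_mul_partialDeriv hf (hg.partialDeriv i) hfc,
      integral_mul_partialDeriv (hf.partialDeriv i) hg (hfc.partialDeriv i), neg_neg]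
  · exact fun i _ => (((hf.partialDeriv i).partialDeriv i).continuous.mul
      hg.continuous).integrable_of_hasCompactSupport
        ((hfc.partialDeriv i).partialDeriv i).mul_right
  · exact fun i _ => (hf.continuous.mul
      ((hg.partialDeriv i).partialDeriv i).continuous).integrable_of_hasCompactSupport
        hfc.mul_right

lemma tsupport_partialDeriv_subset (i : Fin n) (f : E → ℝ) :
    tsupport (partialDeriv i f) ⊆ tsupport f :=
  tsupport_fderiv_apply_subset ℝ _

lemma lap_eq_zero_of_notMem_tsupport {f : E → ℝ} {x : E} (h : x ∉ tsupport f) :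
    lap f x = 0 := by
  rw [lap_eq_sum_partialDeriv]
  exact Finset.sum_eq_zero fun i _ => image_eq_zero_of_notMem_tsupport fun h' =>
    h (tsupport_partialDeriv_subset i f (tsupport_partialDeriv_subset i _ h'))

lemma HasCompactSupport.lap {f : E → ℝ} (hf : HasCompactSupport f) :
    HasCompactSupport (lap f) :=
  hf.mono' fun _ hx => by_contra fun h => hx (lap_eq_zero_of_notMem_tsupport h)

lemma quadratic_lower_bound {K L e l A b W w v : ℝ} (hl : |l| ≤ L) (hA₀ : 0 ≤ A) (hA : A ≤ K)
    (hW : 0 ≤ W) (hb : b ^ 2 ≤ A * W) :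
    -(((2 * L + 72 * K) ^ 2 + 32 * K * L) * w ^ 2) ≤
      (e ^ 4 * v + 8 * e ^ 3 * b + w * (2 * e ^ 2 * l + 8 * e ^ 2 * A)) * v +
        32 * K * (e ^ 2 * (2 * w * v + 2 * W) - l * w ^ 2) := by
  have hK : 0 ≤ K := hA₀.trans hA
  obtain ⟨hl₁, hl₂⟩ := abs_le.1 hl
  have hbK : e ^ 2 * b ^ 2 ≤ e ^ 2 * (K * W) := by gcongr; nlinarith
  have hq : (2 * l + 8 * A + 64 * K) ^ 2 * w ^ 2 ≤ (2 * L + 72 * K) ^ 2 * w ^ 2 := by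
    refine mul_le_mul_of_nonneg_right (sq_le_sq' ?_ ?_) (sq_nonneg w) <;> linarith
  have hlw : K * (l * w ^ 2) ≤ K * (L * w ^ 2) := by gcongr
  nlinarith [sq_nonneg (e ^ 2 * v / 2 + 8 * e * b),
    sq_nonneg (e ^ 2 * v / 2 + (2 * l + 8 * A + 64 * K) * w), sq_nonneg (e ^ 2 * v)]

/-- Localised lower bound for the bilaplacian: testing `Δ²w` against `η⁴w` loses at most a multiple
of the `L²` norm of `w` on the support of `η`, with a constant depending only on `η`. -/
lemma exists_integral_mul_lap_lap_ge {η : E → ℝ} (hη : ContDiff ℝ (⊤ : ℕ∞) η)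
    (hηc : HasCompactSupport η) :
    ∃ C : ℝ, 0 ≤ C ∧ ∀ w : E → ℝ, ContDiff ℝ (⊤ : ℕ∞) w →
      -(C * ∫ x in tsupport η, w x ^ 2) ≤ ∫ x, η x ^ 4 * w x * lap (lap w) x := by
  have hη₂ : ContDiff ℝ (⊤ : ℕ∞) (η * η) := hη.mul hη
  have hη₂c : HasCompactSupport (η * η) := hηc.mul_right
  have hη₄ : ContDiff ℝ (⊤ : ℕ∞) (η * η * (η * η)) := hη₂.mul hη₂
  obtain ⟨K, hK⟩ := hηc.isCompact.exists_bound_of_continuousOn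
    (hη.gradInner hη).continuous.continuousOn
  obtain ⟨L, hL⟩ := hηc.isCompact.exists_bound_of_continuousOn hη₂.lap.continuous.continuousOn
  refine ⟨(2 * |L| + 72 * |K|) ^ 2 + 32 * |K| * |L|, by positivity, fun w hw => ?_⟩
  set C := (2 * |L| + 72 * |K|) ^ 2 + 32 * |K| * |L|
  set P : E → ℝ := fun x => lap (η * η * (η * η) * w) x * lap w x +
    32 * |K| * ((η * η) x * lap (w * w) x - lap (η * η) x * (w * w) x) with hP
  have hφw : ContDiff ℝ (⊤ : ℕ∞) (η * η * (η * η) * w) := hη₄.mul hw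
  have hφwc : HasCompactSupport (η * η * (η * η) * w) := (hη₂c.mul_right).mul_right
  have hww : ContDiff ℝ (⊤ : ℕ∞) (w * w) := hw.mul hw
  have hPcont : Continuous P := by
    have h₁ := hφw.lap.continuous
    have h₂ := hw.lap.continuous
    have h₃ := hη₂.lap.continuous
    have h₄ := hww.lap.continuous
    have h₅ := hη₂.continuous
    have h₆ := hww.continuous
    fun_prop
  have hPint : ∫ x, P x = ∫ x, η x ^ 4 * w x * lap (lap w) x := by
    have i₁ : Integrable fun x => lap (η * η * (η * η) * w) x * lap w x :=
      (hφw.lap.continuous.mul hw.lap.continuous).integrable_of_hasCompactSupport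
        hφwc.lap.mul_right
    have i₂ : Integrable fun x => (η * η) x * lap (w * w) x :=
      (hη₂.continuous.mul hww.lap.continuous).integrable_of_hasCompactSupport hη₂c.mul_right
    have i₃ : Integrable fun x => lap (η * η) x * (w * w) x :=
      (hη₂.lap.continuous.mul hww.continuous).integrable_of_hasCompactSupport hη₂c.lap.mul_right
    have i₄ : Integrable fun x => 32 * |K| *
        ((η * η) x * lap (w * w) x - lap (η * η) x * (w * w) x) := (i₂.sub i₃).const_mul _
    rw [hP, integral_add i₁ i₄, integral_const_mul, integral_sub i₂ i₃,
      integral_mul_lap hη₂ hww hη₂c, ← integral_mul_lap hφw hw.lap hφwc]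
    simp only [sub_self, mul_zero, add_zero, Pi.mul_apply]
    congr 1 with x
    ring
  have hsub : ∀ g : E → ℝ, tsupport (η * g) ⊆ tsupport η := fun g => tsupport_mul_subset_left
  have hPzero : ∀ x, x ∉ tsupport η → P x = 0 := by
    intro x hx
    have h₁ : lap (η * η * (η * η) * w) x = 0 := lap_eq_zero_of_notMem_tsupport fun h => by
      rw [mul_assoc, mul_assoc] at h
      exact hx (hsub _ h)
    have h₂ : lap (η * η) x = 0 := lap_eq_zero_of_notMem_tsupport fun h => hx (hsub _ h)
    simp [hP, h₁, h₂, image_eq_zero_of_notMem_tsupport hx]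
  rw [← hPint, ← setIntegral_eq_integral_of_forall_compl_eq_zero hPzero, ← integral_const_mul,
    ← integral_neg]
  refine setIntegral_mono_on ?_ ?_ (isClosed_tsupport η).measurableSet fun x hx => ?_
  · exact ((by have := hw.continuous; fun_prop :
      Continuous fun x => -(C * w x ^ 2)).continuousOn).integrableOn_compact hηc
  · exact hPcont.continuousOn.integrableOn_compact hηc
  · have hφ : gradInner (η * η * (η * η)) w x = 4 * η x ^ 3 * gradInner η w x := by
      rw [gradInner_mul_left hη₂ hη₂, gradInner_mul_left hη hη]
      simp only [Pi.mul_apply]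
      ring
    have hη' : gradInner (η * η) (η * η) x = 4 * η x ^ 2 * gradInner η η x := by
      rw [gradInner_mul_left hη hη, gradInner_comm, gradInner_mul_left hη hη]
      ring
    have := quadratic_lower_bound (e := η x) (w := w x) (v := lap w x)
      ((hL x hx).trans (le_abs_self L)) (gradInner_self_nonneg η x)
      ((le_abs_self _).trans ((hK x hx).trans (le_abs_self K)))
      (gradInner_self_nonneg w x) (gradInner_sq_le η w x)
    refine this.trans_eq ?_
    simp only [hP]
    rw [lap_mul hη₄ hw, lap_mul hη₂ hη₂, lap_mul hw hw, hφ, hη']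
    simp only [Pi.mul_apply]
    ring

end SpatialEstimate

/-- Differentiation under the integral over a compact set. -/
lemma hasDerivAt_setIntegral_of_isCompact {X : Type*} [TopologicalSpace X]
    [TopologicalSpace.PseudoMetrizableSpace X]
    [MeasurableSpace X] [BorelSpace X] {μ : Measure X} [IsFiniteMeasureOnCompacts μ]
    {K : Set X} (hK : IsCompact K) (hKm : MeasurableSet K) {I : Set ℝ} (hI : IsOpen I)
    {G G' : X → ℝ → ℝ}
    (hG : ContinuousOn (fun p : X × ℝ => G p.1 p.2) {p | p.2 ∈ I})
    (hG' : ContinuousOn (fun p : X × ℝ => G' p.1 p.2) {p | p.2 ∈ I})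
    (hderiv : ∀ x, ∀ t ∈ I, HasDerivAt (G x) (G' x t) t) {t : ℝ} (ht : t ∈ I) :
    HasDerivAt (fun s => ∫ x in K, G x s ∂μ) (∫ x in K, G' x t ∂μ) t := by
  have slice {H : X → ℝ → ℝ} (hH : ContinuousOn (fun p : X × ℝ => H p.1 p.2) {p | p.2 ∈ I})
      {s : ℝ} (hs : s ∈ I) : IntegrableOn (fun x => H x s) K μ :=
    (hH.comp (by fun_prop : ContinuousOn (fun x : X => (x, s)) K)
      fun _ _ => hs).integrableOn_compact' hK hKm
  obtain ⟨ε, hε, hball⟩ := Metric.nhds_basis_closedBall.mem_iff.1 (hI.mem_nhds ht)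
  obtain ⟨M, hM⟩ := (hK.prod (isCompact_closedBall t ε)).exists_bound_of_continuousOn
    (hG'.mono fun p hp => hball hp.2)
  refine (hasDerivAt_integral_of_dominated_loc_of_deriv_le (μ := μ.restrict K)
    (F := fun s x => G x s) (F' := fun s x => G' x s) (bound := fun _ => M)
    (Metric.closedBall_mem_nhds t hε) ?_ (slice hG ht) (slice hG' ht).aestronglyMeasurable ?_ ?_
    ?_).2
  · filter_upwards [hI.mem_nhds ht] with s hs using (slice hG hs).aestronglyMeasurable
  · exact (ae_restrict_iff' hKm).2 (ae_of_all _ fun x hx s hs => hM (x, s) ⟨hx, hs⟩)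
  · exact integrableOn_const hK.measure_lt_top.ne
  · exact ae_of_all _ fun x s hs => hderiv x s (hball hs)

section EnergyEstimate

variable {n : ℕ} {T : ℝ}

local notation "E" => EuclideanSpace ℝ (Fin n)

lemma IsBiharmonicHeatSol.contDiffOn_Ioo {u : E → ℝ → ℝ}
    (hu : IsBiharmonicHeatSol u {p | p.2 ∈ Ioc 0 T}) :
    ContDiffOn ℝ (⊤ : ℕ∞) (fun p : E × ℝ => u p.1 p.2) {p | p.2 ∈ Ioo 0 T} :=
  hu.1.mono fun _ hp => Ioo_subset_Ioc_self hp

lemma isOpen_snd_mem_Ioo : IsOpen {p : E × ℝ | p.2 ∈ Ioo 0 T} :=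
  isOpen_Ioo.preimage continuous_snd

lemma IsBiharmonicHeatSol.contDiff_slice {u : E → ℝ → ℝ}
    (hu : IsBiharmonicHeatSol u {p | p.2 ∈ Ioc 0 T}) {t : ℝ} (ht : t ∈ Ioo 0 T) :
    ContDiff ℝ (⊤ : ℕ∞) (fun x => u x t) :=
  contDiffOn_univ.1 <| hu.contDiffOn_Ioo.comp
    (contDiff_id.prodMk contDiff_const : ContDiff ℝ (⊤ : ℕ∞) fun x : E => (x, t)).contDiffOn
    fun _ _ => ht

lemma IsBiharmonicHeatSol.hasDerivAt {u : E → ℝ → ℝ}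
    (hu : IsBiharmonicHeatSol u {p | p.2 ∈ Ioc 0 T}) {t : ℝ} (ht : t ∈ Ioo 0 T) (x : E) :
    HasDerivAt (u x) (-(lap (lap (fun y => u y t)) x)) t :=
  (hu.2 (x, t) (Ioo_subset_Ioc_self ht)).hasDerivAt (Ioc_mem_nhds ht.1 ht.2)

lemma IsBiharmonicHeatSol.continuousOn_lap_lap {u : E → ℝ → ℝ}
    (hu : IsBiharmonicHeatSol u {p | p.2 ∈ Ioc 0 T}) :
    ContinuousOn (fun p : E × ℝ => lap (lap (fun y => u y p.2)) p.1) {p | p.2 ∈ Ioo 0 T} := by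
  have hfd := hu.contDiffOn_Ioo.continuousOn_fderiv_of_isOpen isOpen_snd_mem_Ioo (by simp)
  refine (hfd.clm_apply (continuousOn_const (c := ((0 : E), (1 : ℝ))))).neg.congr fun p hp => ?_
  have h₁ := ((hu.contDiffOn_Ioo.contDiffAt (isOpen_snd_mem_Ioo.mem_nhds hp)).differentiableAt
    (by simp)).hasFDerivAt.comp_hasDerivAt p.2
      ((hasDerivAt_const p.2 p.1).prodMk (hasDerivAt_id p.2))
  exact neg_eq_iff_eq_neg.1 ((hu.hasDerivAt hp p.1).unique h₁)

/-- The cut-off `L²` energy of a solution of the biharmonic heat equation grows at most at a rate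
controlled by the `L²` norm on the support of the cut-off. -/
lemma IsBiharmonicHeatSol.exists_energy_estimate {u : E → ℝ → ℝ}
    (hu : IsBiharmonicHeatSol u {p | p.2 ∈ Ioc 0 T}) {η : E → ℝ}
    (hη : ContDiff ℝ (⊤ : ℕ∞) η) (hηc : HasCompactSupport η) :
    ∃ C : ℝ, 0 ≤ C ∧ ∀ t ∈ Ioo 0 T, ∃ D ≤ C * ∫ x in tsupport η, u x t ^ 2,
      HasDerivAt (fun s => ∫ x in tsupport η, η x ^ 4 * u x s ^ 2) D t := by
  obtain ⟨C, hC, hCw⟩ := exists_integral_mul_lap_lap_ge hη hηc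
  refine ⟨2 * C, by positivity, fun t ht => ⟨_, ?_, hasDerivAt_setIntegral_of_isCompact
    (G' := fun x s => η x ^ 4 * (2 * u x s * -(lap (lap fun y => u y s) x))) hηc
    (isClosed_tsupport η).measurableSet isOpen_Ioo ?_ ?_ ?_ ht⟩⟩
  · have h := hCw _ (hu.contDiff_slice ht)
    rw [setIntegral_eq_integral_of_forall_compl_eq_zero fun x hx => by
      simp [image_eq_zero_of_notMem_tsupport hx]]
    have hD : ∫ x, η x ^ 4 * (2 * u x t * -(lap (lap fun y => u y t) x)) =
        -2 * ∫ x, η x ^ 4 * u x t * lap (lap fun y => u y t) x := by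
      rw [← integral_const_mul]
      congr 1 with x
      ring
    rw [hD]
    linarith
  · have h₁ := hu.contDiffOn_Ioo.continuousOn
    have h₂ := hη.continuous
    fun_prop
  · have h₁ := hu.contDiffOn_Ioo.continuousOn
    have h₂ := hη.continuous
    have h₃ := hu.continuousOn_lap_lap
    fun_prop
  · intro x s hs
    simpa using ((hu.hasDerivAt hs x).pow 2).const_mul (η x ^ 4)

end EnergyEstimate

/-- Strong vanishing of the local `L²` norm as `t → 0⁺` (Lemma 6.2 of the paper,
Euclidean case): if `∫_Ω u(·,t)² → 0` as `t → 0⁺` for every compact `Ω`, then in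
fact `t⁻¹ ∫_{B(0,R)} u(·,t)² → 0` as `t → 0⁺`, for every `R > 0`. -/
theorem biharmonic_heat_strong_vanishing (n : ℕ) (hn : 1 ≤ n) (T : ℝ) (hT : 0 < T)
    (u : EuclideanSpace ℝ (Fin n) → ℝ → ℝ)
    (hu : IsBiharmonicHeatSol u {p | p.2 ∈ Set.Ioc 0 T})
    (hinit : ∀ Ω : Set (EuclideanSpace ℝ (Fin n)), IsCompact Ω →
      Tendsto (fun t => ∫ x in Ω, (u x t) ^ 2) (nhdsWithin 0 (Set.Ioi 0)) (nhds 0)) :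
    ∀ R : ℝ, 0 < R →
      Tendsto (fun t => (1 / t) * ∫ x in Metric.ball (0 : EuclideanSpace ℝ (Fin n)) R,
          (u x t) ^ 2)
        (nhdsWithin 0 (Set.Ioi 0)) (nhds 0) := by
  intro R hR
  let η : ContDiffBump (0 : EuclideanSpace ℝ (Fin n)) := ⟨R, R + 1, hR, lt_add_one R⟩
  have hηs : ContDiff ℝ (⊤ : ℕ∞) η := η.contDiff
  have hK : IsCompact (tsupport η) := η.hasCompactSupport
  have hKm : MeasurableSet (tsupport η) := (isClosed_tsupport η).measurableSet
  obtain ⟨C, hC, hen⟩ := hu.exists_energy_estimate hηs η.hasCompactSupport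
  set F : ℝ → ℝ := fun s => ∫ x in tsupport η, η x ^ 4 * u x s ^ 2 with hF
  set f : ℝ → ℝ := fun s => ∫ x in tsupport η, u x s ^ 2 with hf
  have hf0 : Tendsto f (nhdsWithin 0 (Ioi 0)) (nhds 0) := hinit _ hK
  have int_sq {t : ℝ} (ht : t ∈ Ioo 0 T) : IntegrableOn (fun x => u x t ^ 2) (tsupport η) :=
    ((hu.contDiff_slice ht).continuous.pow 2).continuousOn.integrableOn_compact hK
  have int_cut {t : ℝ} (ht : t ∈ Ioo 0 T) :
      IntegrableOn (fun x => η x ^ 4 * u x t ^ 2) (tsupport η) :=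
    ((η.continuous.pow 4).mul
      ((hu.contDiff_slice ht).continuous.pow 2)).continuousOn.integrableOn_compact hK
  have hFf {t : ℝ} (ht : t ∈ Ioo 0 T) : F t ≤ f t :=
    setIntegral_mono_on (int_cut ht) (int_sq ht) hKm fun x _ =>
      mul_le_of_le_one_left (sq_nonneg _) (pow_le_one₀ η.nonneg η.le_one)
  have hball {t : ℝ} (ht : t ∈ Ioo 0 T) : ∫ x in ball 0 R, u x t ^ 2 ≤ F t := by
    have hsub : ball 0 R ⊆ tsupport η := by
      rw [η.tsupport_eq]
      exact ball_subset_closedBall.trans (closedBall_subset_closedBall (lt_add_one R).le)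
    calc ∫ x in ball 0 R, u x t ^ 2 = ∫ x in ball 0 R, η x ^ 4 * u x t ^ 2 :=
          setIntegral_congr_fun measurableSet_ball fun x hx => by
            simp [η.one_of_mem_closedBall (ball_subset_closedBall hx)]
      _ ≤ F t := setIntegral_mono_set (int_cut ht) (ae_of_all _ fun x => by positivity)
          hsub.eventuallyLE
  rw [Metric.tendsto_nhdsWithin_nhds] at hf0 ⊢
  intro ε hε
  obtain ⟨δ, hδ, hfδ⟩ := hf0 (ε / (C + 1)) (by positivity)
  refine ⟨min δ T, lt_min hδ hT, fun t (ht0 : 0 < t) htd => ?_⟩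
  rw [Real.dist_0_eq_abs, abs_of_pos ht0, lt_min_iff] at htd
  have htT : t ∈ Ioo 0 T := ⟨ht0, htd.2⟩
  have hderiv : ∀ s ∈ Ioc 0 t, DifferentiableAt ℝ F s ∧ deriv F s ≤ C * (ε / (C + 1)) := by
    intro s hs
    obtain ⟨D, hD, hFD⟩ := hen s ⟨hs.1, hs.2.trans_lt htd.2⟩
    have h := hfδ hs.1 (by
      rw [Real.dist_0_eq_abs, abs_of_pos hs.1]
      exact hs.2.trans_lt htd.1)
    rw [Real.dist_0_eq_abs] at h
    exact ⟨hFD.differentiableAt, hFD.deriv ▸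
      hD.trans (mul_le_mul_of_nonneg_left ((le_abs_self _).trans h.le) hC)⟩
  have hFt : F t ≤ C * (ε / (C + 1)) * t + 0 := by
    refine ge_of_tendsto ((hinit _ hK).const_add (C * (ε / (C + 1)) * t)) ?_
    filter_upwards [Ioc_mem_nhdsGT ht0] with s hs
    have hmv := (convex_Ioc 0 t).image_sub_le_mul_sub_of_deriv_le
      (fun r hr => (hderiv r hr).1.continuousAt.continuousWithinAt)
      (fun r hr => (hderiv r (interior_subset hr)).1.differentiableWithinAt)
      (fun r hr => (hderiv r (interior_subset hr)).2) s hs t (right_mem_Ioc.2 ht0) hs.2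
    have hFs : F s ≤ f s := hFf ⟨hs.1, hs.2.trans_lt htd.2⟩
    have : 0 ≤ C * (ε / (C + 1)) * s := mul_nonneg (by positivity) hs.1.le
    simp only [hf] at hFs
    linarith
  have hint : 0 ≤ ∫ x in ball 0 R, u x t ^ 2 := integral_nonneg fun x => sq_nonneg _
  rw [Real.dist_0_eq_abs, abs_of_nonneg (by positivity), one_div_mul_eq_div, div_lt_iff₀ ht0]
  have hCε : C * (ε / (C + 1)) < ε := by
    rw [mul_div_assoc', div_lt_iff₀ (by positivity)]
    linarith
  nlinarith [hball htT, mul_lt_mul_of_pos_right hCε ht0]
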